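/- Let Φ be a norm on ℝ^{n+1} cylindrical over a norm φ on ℝ^n, Ω̂ ⊆ ℝ^n an open set, and u ∈ BV_loc(Ω̂). If for almost every λ ∈ ℝ the superlevel set {x ∈ Ω̂ : u(x) > λ} is a minimizer of P_φ in Ω̂, then u ∈ M_{Φ^o}(Ω̂). -/

import Mathlib

open MeasureTheory Set Filter

noncomputable section

/-- `ℝ^n` with the Euclidean norm. -/
abbrev Rn (n : ℕ) := EuclideanSpace ℝ (Fin n)

/-- `ℝ^{n+1} = ℝ^n × ℝ`. -/
abbrev Rn1 (n : ℕ) := Rn n × ℝ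

/-- Euclidean dot product on `ℝ^n`. -/
def dotn {n : ℕ} (x y : Rn n) : ℝ := ∑ i, x i * y i

/-- Euclidean dot product on `ℝ^{n+1} = ℝ^n × ℝ`. -/
def dotp {n : ℕ} (x y : Rn1 n) : ℝ := dotn x.1 y.1 + x.2 * y.2

/-- Euclidean norm on `ℝ^{n+1} = ℝ^n × ℝ`. -/
def enorm1 {n : ℕ} (x : Rn1 n) : ℝ := Real.sqrt (dotp x x)

/-- `Ψ` is a norm on `ℝ^n`: convex, absolutely one-homogeneous and bounded
below by a positive multiple of the Euclidean norm. -/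
def IsNormN {n : ℕ} (Ψ : Rn n → ℝ) : Prop :=
  ConvexOn ℝ univ Ψ ∧ (∀ (c : ℝ) (ξ : Rn n), Ψ (c • ξ) = |c| * Ψ ξ) ∧
    ∃ c > (0:ℝ), ∀ ξ, c * ‖ξ‖ ≤ Ψ ξ

/-- `Φ` is a norm on `ℝ^{n+1}`. -/
def IsNorm1 {n : ℕ} (Φ : Rn1 n → ℝ) : Prop :=
  ConvexOn ℝ univ Φ ∧ (∀ (c : ℝ) (ξ : Rn1 n), Φ (c • ξ) = |c| * Φ ξ) ∧
    ∃ c > (0:ℝ), ∀ ξ, c * enorm1 ξ ≤ Φ ξ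

/-- Dual norm on `ℝ^n`: `Ψ^o(ξ*) = sup {ξ*·ξ : Ψ(ξ) ≤ 1}`. -/
def dualN {n : ℕ} (Ψ : Rn n → ℝ) (xs : Rn n) : ℝ :=
  sSup ((fun ξ => dotn xs ξ) '' {ξ | Ψ ξ ≤ 1})

/-- Dual norm on `ℝ^{n+1}`. -/
def dual1 {n : ℕ} (Φ : Rn1 n → ℝ) (xs : Rn1 n) : ℝ :=
  sSup ((fun ξ => dotp xs ξ) '' {ξ | Φ ξ ≤ 1})

/-- `Φ` is cylindrical over `φ`: `Φ(ξ̂,ξ_{n+1}) = max (φ(ξ̂), |ξ_{n+1}|)`. -/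
def Cylindrical {n : ℕ} (Φ : Rn1 n → ℝ) (φ : Rn n → ℝ) : Prop :=
  ∀ ξ : Rn1 n, Φ ξ = max (φ ξ.1) |ξ.2|

/-- `A` is an open set compactly contained in `O`. -/
def CpCtd {E : Type*} [TopologicalSpace E] (A O : Set E) : Prop :=
  IsOpen A ∧ IsCompact (closure A) ∧ closure A ⊆ O

/-- Divergence of a vector field on `ℝ^n`. -/
def divN {n : ℕ} (η : Rn n → Rn n) (x : Rn n) : ℝ :=
  ∑ i, fderiv ℝ η x (EuclideanSpace.single i (1:ℝ)) i

/-- Divergence of a vector field on `ℝ^{n+1} = ℝ^n × ℝ`. -/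
def div1 {n : ℕ} (η : Rn1 n → Rn1 n) (z : Rn1 n) : ℝ :=
  (∑ i, (fderiv ℝ η z (EuclideanSpace.single i (1:ℝ), (0:ℝ))).1 i) +
    (fderiv ℝ η z ((0 : Rn n), (1:ℝ))).2

/-- Admissible test vector fields on `ℝ^n`: `C^1`, compactly supported in `A`,
with values in the unit ball of `Ψ`. -/
def TestN {n : ℕ} (A : Set (Rn n)) (Ψ : Rn n → ℝ) (η : Rn n → Rn n) : Prop :=
  ContDiff ℝ 1 η ∧ HasCompactSupport η ∧ tsupport η ⊆ A ∧ ∀ x, Ψ (η x) ≤ 1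

/-- Admissible test vector fields on `ℝ^{n+1}`. -/
def Test1 {n : ℕ} (A : Set (Rn1 n)) (Φ : Rn1 n → ℝ) (η : Rn1 n → Rn1 n) : Prop :=
  ContDiff ℝ 1 η ∧ HasCompactSupport η ∧ tsupport η ⊆ A ∧ ∀ z, Φ (η z) ≤ 1

/-- The set of numbers whose supremum is the anisotropic perimeter `P_Ψ(E,A)` in `ℝ^n`. -/
def perSetN {n : ℕ} (Ψ : Rn n → ℝ) (E A : Set (Rn n)) : Set ℝ :=
  {r | ∃ η, TestN A Ψ η ∧ r = -∫ x in E, divN η x}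

/-- Anisotropic perimeter `P_Ψ(E,A)` in `ℝ^n`. -/
def PerN {n : ℕ} (Ψ : Rn n → ℝ) (E A : Set (Rn n)) : ℝ := sSup (perSetN Ψ E A)

/-- `E` has locally finite perimeter in `O ⊆ ℝ^n`. -/
def BVlocSetN {n : ℕ} (O E : Set (Rn n)) : Prop :=
  ∀ A, CpCtd A O → BddAbove (perSetN (fun x => ‖x‖) E A)

/-- `E` is a minimizer of `P_Ψ` (by compact perturbations) in `O ⊆ ℝ^n`. -/
def MinPerN {n : ℕ} (Ψ : Rn n → ℝ) (O E : Set (Rn n)) : Prop :=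
  BVlocSetN O E ∧ ∀ A, CpCtd A O → ∀ F, BVlocSetN O F →
    IsCompact (closure (symmDiff E F)) → closure (symmDiff E F) ⊆ A →
      PerN Ψ E A ≤ PerN Ψ F A

/-- The set of numbers whose supremum is the anisotropic perimeter `P_Φ(E,A)` in `ℝ^{n+1}`. -/
def perSet1 {n : ℕ} (Φ : Rn1 n → ℝ) (E A : Set (Rn1 n)) : Set ℝ :=
  {r | ∃ η, Test1 A Φ η ∧ r = -∫ z in E, div1 η z}

/-- Anisotropic perimeter `P_Φ(E,A)` in `ℝ^{n+1}`. -/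
def Per1 {n : ℕ} (Φ : Rn1 n → ℝ) (E A : Set (Rn1 n)) : ℝ := sSup (perSet1 Φ E A)

/-- `E` has locally finite perimeter in `O ⊆ ℝ^{n+1}`. -/
def BVlocSet1 {n : ℕ} (O E : Set (Rn1 n)) : Prop :=
  ∀ A, CpCtd A O → BddAbove (perSet1 enorm1 E A)

/-- `E` is a minimizer of `P_Φ` (by compact perturbations) in `O ⊆ ℝ^{n+1}`. -/
def MinPer1 {n : ℕ} (Φ : Rn1 n → ℝ) (O E : Set (Rn1 n)) : Prop :=
  BVlocSet1 O E ∧ ∀ A, CpCtd A O → ∀ F, BVlocSet1 O F →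
    IsCompact (closure (symmDiff E F)) → closure (symmDiff E F) ⊆ A →
      Per1 Φ E A ≤ Per1 Φ F A

/-- The set of numbers whose supremum is the total variation `TV(u,A)`. -/
def varSet {n : ℕ} (A : Set (Rn n)) (u : Rn n → ℝ) : Set ℝ :=
  {r | ∃ η, TestN A (fun x => ‖x‖) η ∧ r = ∫ x in A, u x * divN η x}

/-- Total variation `TV(u,A)`. -/
def TV {n : ℕ} (u : Rn n → ℝ) (A : Set (Rn n)) : ℝ := sSup (varSet A u)

/-- `u ∈ BV_loc(Ω̂)`. -/
def BVlocFun {n : ℕ} (Ω : Set (Rn n)) (u : Rn n → ℝ) : Prop :=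
  (∀ A, CpCtd A Ω → IntegrableOn u A) ∧ ∀ A, CpCtd A Ω → BddAbove (varSet A u)

/-- The set of numbers whose supremum is `G_{Φ^o}(u,A)`. -/
def Gset {n : ℕ} (Φ : Rn1 n → ℝ) (A : Set (Rn n)) (u : Rn n → ℝ) : Set ℝ :=
  {r | ∃ η : Rn n → Rn1 n, ContDiff ℝ 1 η ∧ HasCompactSupport η ∧ tsupport η ⊆ A ∧
    (∀ x, Φ (η x) ≤ 1) ∧ r = ∫ x in A, (u x * divN (fun y => (η y).1) x + (η x).2)}

/-- The functional `G_{Φ^o}(u,A)`. -/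
def Gfun {n : ℕ} (Φ : Rn1 n → ℝ) (u : Rn n → ℝ) (A : Set (Rn n)) : ℝ := sSup (Gset Φ A u)

/-- `w` has compact support contained in `A`. -/
def CptSupp {n : ℕ} (A : Set (Rn n)) (w : Rn n → ℝ) : Prop :=
  IsCompact (tsupport w) ∧ tsupport w ⊆ A

/-- `u` is a minimizer of `G_{Φ^o}` by compact perturbations in `Ω̂`,
i.e. `u ∈ M_{Φ^o}(Ω̂)`. -/
def MinG {n : ℕ} (Φ : Rn1 n → ℝ) (Ω : Set (Rn n)) (u : Rn n → ℝ) : Prop :=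
  BVlocFun Ω u ∧ ∀ A, CpCtd A Ω → ∀ v, BVlocFun Ω v →
    CptSupp A (fun x => u x - v x) → Gfun Φ u A ≤ Gfun Φ v A

/-- `u` is a minimizer of the total variation by compact perturbations in `Ω̂`. -/
def MinTV {n : ℕ} (Ω : Set (Rn n)) (u : Rn n → ℝ) : Prop :=
  BVlocFun Ω u ∧ ∀ A, CpCtd A Ω → ∀ v, BVlocFun Ω v →
    CptSupp A (fun x => u x - v x) → TV u A ≤ TV v A

/-- Subgraph of `u : Ω̂ → ℝ`. -/
def sg {n : ℕ} (Ω : Set (Rn n)) (u : Rn n → ℝ) : Set (Rn1 n) :=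
  {p | p.1 ∈ Ω ∧ p.2 < u p.1}

/-- `S` is locally a Lipschitz graph at `p`. -/
def IsLocLipGraphAt {n : ℕ} (S : Set (Rn1 n)) (p : Rn1 n) : Prop :=
  ∃ U : Set (Rn1 n), IsOpen U ∧ p ∈ U ∧ ∃ e : Rn1 n, enorm1 e = 1 ∧
    ∃ g : Rn1 n → ℝ, (∃ L : NNReal, LipschitzOnWith L g {y | dotp y e = 0}) ∧
      S ∩ U = {z | ∃ y, dotp y e = 0 ∧ z = y + g y • e} ∩ U

/-- `Φ` is a partially monotone norm on `ℝ^{n+1}`. -/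
def PartMono {n : ℕ} (Φ : Rn1 n → ℝ) : Prop :=
  ∀ ξ η : Rn1 n, Φ (ξ.1, 0) ≤ Φ (η.1, 0) → Φ ((0 : Rn n), ξ.2) ≤ Φ ((0 : Rn n), η.2) →
    Φ ξ ≤ Φ η

end


open Function in
theorem divN_add' {n : ℕ} {η ζ : Rn n → Rn n} {x : Rn n} (h1 : DifferentiableAt ℝ η x)
    (h2 : DifferentiableAt ℝ ζ x) :
    divN (fun y => η y + ζ y) x = divN η x + divN ζ x := by
  unfold divN
  rw [fderiv_fun_add h1 h2, ← Finset.sum_add_distrib]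
  rfl

theorem divN_smul' {n : ℕ} {a : Rn n → ℝ} {η : Rn n → Rn n} {x : Rn n}
    (h1 : DifferentiableAt ℝ a x) (h2 : DifferentiableAt ℝ η x) :
    divN (fun y => a y • η y) x = a x * divN η x + fderiv ℝ a x (η x) := by
  unfold divN
  rw [fderiv_fun_smul h1 h2]
  have : η x = ∑ i, (η x i) • EuclideanSpace.single i (1:ℝ) := by
    ext j
    simp [Pi.single_apply]
  conv_rhs => rw [this]
  rw [map_sum, Finset.mul_sum, ← Finset.sum_add_distrib]
  refine Finset.sum_congr rfl fun i _ => ?_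
  simp [mul_comm]

theorem divN_const_smul' {n : ℕ} (c : ℝ) (η : Rn n → Rn n) (x : Rn n)
    (h2 : DifferentiableAt ℝ η x) :
    divN (fun y => c • η y) x = c * divN η x := by
  rw [divN_smul' (differentiableAt_const c) h2]
  simp

theorem divN_neg' {n : ℕ} (η : Rn n → Rn n) (x : Rn n) :
    divN (fun y => - η y) x = - divN η x := by
  unfold divN
  rw [fderiv_fun_neg, ← Finset.sum_neg_distrib]
  rfl

theorem divN_zero_of {n : ℕ} {η : Rn n → Rn n} {x : Rn n} (h : x ∉ tsupport η) :
    divN η x = 0 := by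
  unfold divN
  rw [fderiv_of_notMem_tsupport (𝕜 := ℝ) h]
  simp

theorem divN_cont {n : ℕ} {η : Rn n → Rn n} (h : ContDiff ℝ 1 η) :
    Continuous (divN η) := by
  unfold divN
  have := h.continuous_fderiv (by norm_num)
  fun_prop

theorem divN_cs {n : ℕ} {η : Rn n → Rn n} (h : HasCompactSupport η) :
    HasCompactSupport (divN η) :=
  HasCompactSupport.intro h fun _ hx => divN_zero_of hx

theorem divN_bdd {n : ℕ} {η : Rn n → Rn n} (h : ContDiff ℝ 1 η) (hc : HasCompactSupport η) :
    ∃ C, 0 ≤ C ∧ ∀ x, |divN η x| ≤ C := by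
  obtain ⟨C, hC⟩ := (divN_cs hc).exists_bound_of_continuous (divN_cont h)
  exact ⟨C, (norm_nonneg _).trans (hC 0), hC⟩

theorem divN_integral {n : ℕ} {η : Rn n → Rn n} (h : ContDiff ℝ 1 η)
    (hc : HasCompactSupport η) : ∫ x, divN η x = 0 := by
  have hf := h.continuous_fderiv (by norm_num)
  have hi : ∀ i : Fin n, HasCompactSupport (fun x => fderiv ℝ η x (EuclideanSpace.single i (1:ℝ)) i) := by
    intro i
    refine HasCompactSupport.intro hc fun x hx => ?_
    rw [fderiv_of_notMem_tsupport (𝕜 := ℝ) hx]; simp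
  have hint : ∀ i : Fin n, Integrable (fun x => fderiv ℝ η x (EuclideanSpace.single i (1:ℝ)) i) :=
    fun i => Continuous.integrable_of_hasCompactSupport (by fun_prop) (hi i)
  unfold divN
  rw [integral_finsetSum _ (fun i _ => hint i)]
  refine Finset.sum_eq_zero fun i _ => ?_
  have hd : Differentiable ℝ η := h.differentiable (by norm_num)
  have e : ∀ x, fderiv ℝ η x (EuclideanSpace.single i (1:ℝ)) i
      = fderiv ℝ (fun y => η y i) x (EuclideanSpace.single i (1:ℝ)) := by
    intro x
    have := ((EuclideanSpace.proj (𝕜 := ℝ) i).hasFDerivAt.comp x (hd x).hasFDerivAt).fderiv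
    have h2 : ((EuclideanSpace.proj (𝕜 := ℝ) i : Rn n → ℝ) ∘ η) = fun y => η y i := rfl
    rw [h2] at this
    rw [this]; rfl
  have hint' := hint i
  simp_rw [e] at hint' ⊢
  have hci : HasCompactSupport (fun y => η y i) := by
    refine HasCompactSupport.intro hc fun x hx => ?_
    rw [image_eq_zero_of_notMem_tsupport hx]; simp
  have hηi : Continuous (fun y => η y i) := by
    have := h.continuous
    fun_prop
  have key := integral_mul_fderiv_eq_neg_fderiv_mul_of_integrable (μ := (volume : Measure (Rn n)))
    (f := fun _ : Rn n => (1:ℝ)) (g := fun y => η y i) (v := EuclideanSpace.single i (1:ℝ))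
    (by simp) (by simpa using hint')
    (by simpa using hηi.integrable_of_hasCompactSupport hci)
    (by fun_prop) (by fun_prop)
  simpa using key

theorem divN_translate {n : ℕ} (η : Rn n → Rn n) (t x : Rn n) :
    divN (fun y => η (y + t)) x = divN η (x + t) := by
  unfold divN
  rw [fderiv_comp_add_right]

theorem cs_smul {n : ℕ} (a : Rn n → ℝ) {η : Rn n → Rn n} (h : HasCompactSupport η) :
    HasCompactSupport (fun y => a y • η y) :=
  HasCompactSupport.intro h fun x hx => by
    rw [image_eq_zero_of_notMem_tsupport hx, smul_zero]

theorem cs_add {n : ℕ} {ζ η : Rn n → Rn n} (h : HasCompactSupport η) (h' : HasCompactSupport ζ) :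
    HasCompactSupport (fun y => η y + ζ y) := h.add h'

theorem ibp_pt {n : ℕ} {a q q' : Rn n → ℝ} {η ζ X : Rn n → Rn n} {x : Rn n}
    (hX : X x = (1 - q' x) • η x + q' x • ζ x)
    (da : DifferentiableAt ℝ a x) (dq : DifferentiableAt ℝ q x) (dη : DifferentiableAt ℝ η x)
    (dζ : DifferentiableAt ℝ ζ x) (dX : DifferentiableAt ℝ X x)
    (fq : fderiv ℝ q x = q' x • fderiv ℝ a x) :
    a x * divN X x - ((a x - q x) * divN η x + q x * divN ζ x)
      = divN (fun y => a y • X y) x - (divN (fun y => (a y - q y) • η y) x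
        + divN (fun y => q y • ζ y) x) := by
  rw [divN_smul' da dX, divN_smul' (da.fun_sub dq) dη, divN_smul' dq dζ, fderiv_fun_sub da dq, fq,
    hX]
  simp only [sub_apply, smul_apply, map_add,
      map_smul, smul_eq_mul]
  ring

theorem ibp_aux {n : ℕ} {a q q' : Rn n → ℝ} {η ζ X : Rn n → Rn n}
    (ha : ContDiff ℝ 1 a) (hq : ContDiff ℝ 1 q)
    (hη : ContDiff ℝ 1 η) (hηc : HasCompactSupport η)
    (hζ : ContDiff ℝ 1 ζ) (hζc : HasCompactSupport ζ)
    (hXd : ContDiff ℝ 1 X) (hXc : HasCompactSupport X)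
    (hX : ∀ x, X x = (1 - q' x) • η x + q' x • ζ x)
    (fq : ∀ x, fderiv ℝ q x = q' x • fderiv ℝ a x) :
    ∫ x, a x * divN X x = ∫ x, ((a x - q x) * divN η x + q x * divN ζ x) := by
  have h0 : ContDiff ℝ 1 (fun y => a y • X y) := by fun_prop
  have h1 : ContDiff ℝ 1 (fun y => (a y - q y) • η y) := by fun_prop
  have h2 : ContDiff ℝ 1 (fun y => q y • ζ y) := by fun_prop
  have c0 : HasCompactSupport (fun y => a y • X y) := cs_smul _ hXc
  have c1 : HasCompactSupport (fun y => (a y - q y) • η y) := cs_smul _ hηc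
  have c2 : HasCompactSupport (fun y => q y • ζ y) := cs_smul _ hζc
  have i0 := (divN_cont h0).integrable_of_hasCompactSupport (μ := volume) (divN_cs c0)
  have i1 := (divN_cont h1).integrable_of_hasCompactSupport (μ := volume) (divN_cs c1)
  have i2 := (divN_cont h2).integrable_of_hasCompactSupport (μ := volume) (divN_cs c2)
  have iL : Integrable (fun x => a x * divN X x) (volume : Measure (Rn n)) :=
    (ha.continuous.mul (divN_cont hXd)).integrable_of_hasCompactSupport
      (HasCompactSupport.mul_left (divN_cs hXc))
  have iR1 : Integrable (fun x => (a x - q x) * divN η x) (volume : Measure (Rn n)) :=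
    ((ha.continuous.sub hq.continuous).mul (divN_cont hη)).integrable_of_hasCompactSupport
      (HasCompactSupport.mul_left (divN_cs hηc))
  have iR2 : Integrable (fun x => q x * divN ζ x) (volume : Measure (Rn n)) :=
    (hq.continuous.mul (divN_cont hζ)).integrable_of_hasCompactSupport
      (HasCompactSupport.mul_left (divN_cs hζc))
  have da : Differentiable ℝ a := ha.differentiable (by norm_num)
  have dq : Differentiable ℝ q := hq.differentiable (by norm_num)
  have dη : Differentiable ℝ η := hη.differentiable (by norm_num)
  have dζ : Differentiable ℝ ζ := hζ.differentiable (by norm_num)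
  have dX : Differentiable ℝ X := hXd.differentiable (by norm_num)
  have pt := fun x => ibp_pt (hX x) (da x) (dq x) (dη x) (dζ x) (dX x) (fq x)
  have iR : Integrable (fun x => (a x - q x) * divN η x + q x * divN ζ x)
    (volume : Measure (Rn n)) := iR1.add iR2
  have i12 : Integrable (fun x => divN (fun y => (a y - q y) • η y) x
        + divN (fun y => q y • ζ y) x) (volume : Measure (Rn n)) := i1.add i2
  rw [← sub_eq_zero, ← integral_sub iL iR, integral_congr_ae (Eventually.of_forall pt),
    integral_sub i0 i12, integral_add i1 i2, divN_integral h0 c0, divN_integral h1 c1,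
    divN_integral h2 c2]
  simp

theorem ibp_identity {n : ℕ} {a : Rn n → ℝ} (ha : ContDiff ℝ 1 a) {p p' : ℝ → ℝ}
    (hp : ContDiff ℝ 1 p) (hp' : ContDiff ℝ 1 p') (hd : ∀ s, HasDerivAt p (p' s) s)
    {η ζ : Rn n → Rn n} (hη : ContDiff ℝ 1 η) (hηc : HasCompactSupport η)
    (hζ : ContDiff ℝ 1 ζ) (hζc : HasCompactSupport ζ) :
    ∫ x, a x * divN (fun y => (1 - p' (a y)) • η y + p' (a y) • ζ y) x
      = ∫ x, ((a x - p (a x)) * divN η x + p (a x) * divN ζ x) := by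
  have hq : ContDiff ℝ 1 (fun y => p (a y)) := hp.comp ha
  have hq' : ContDiff ℝ 1 (fun y => p' (a y)) := hp'.comp ha
  have da : Differentiable ℝ a := ha.differentiable (by norm_num)
  exact ibp_aux (q := fun y => p (a y)) (q' := fun y => p' (a y)) ha hq hη hηc hζ hζc
    (((contDiff_const.sub hq').smul hη).add (hq'.smul hζ))
    (cs_add (cs_smul _ hηc) (cs_smul _ hζc)) (fun _ => rfl)
    (fun x => ((hd (a x)).comp_hasFDerivAt x (da x).hasFDerivAt).fderiv)

open scoped Convolution in
theorem moll_L1 {n : ℕ} {A : Set (Rn n)} (hA : volume A ≠ ⊤) {w : Rn n → ℝ} (hw : Integrable w)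
    {ε κ : ℝ} (hε : 0 < ε) (hκ : 0 < κ) :
    ∃ b : ContDiffBump (0 : Rn n), b.rOut < ε ∧
      ∫ x in A, |(b.normed volume ⋆[ContinuousLinearMap.lsmul ℝ ℝ, volume] w) x - w x| ≤ κ := by
  obtain ⟨g, gc, hg, gcont, gint⟩ := hw.exists_hasCompactSupport_integral_sub_le
    (ε := κ / 3) (by positivity)
  set V := (volume A).toReal with hV
  have hV0 : 0 ≤ V := ENNReal.toReal_nonneg
  set τ := κ / 3 / (V + 1) with hτ
  have hτ0 : 0 < τ := by positivity
  obtain ⟨δ, hδ, hgδ⟩ := Metric.uniformContinuous_iff.1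
    (gc.uniformContinuous_of_continuous gcont) τ hτ0
  set r := min δ ε / 2 with hr
  have hm : 0 < min δ ε := lt_min hδ hε
  have hr0 : 0 < r := by positivity
  let b : ContDiffBump (0 : Rn n) := ⟨r / 2, r, by positivity, by linarith⟩
  have hbr : b.rOut = r := rfl
  refine ⟨b, by rw [hbr]; have := min_le_right δ ε; linarith, ?_⟩
  set ρ := b.normed (volume : Measure (Rn n)) with hρ
  have hρi : Integrable ρ := b.integrable_normed
  have hh : Integrable (fun x => w x - g x) := hw.sub gint
  set L := ContinuousLinearMap.lsmul ℝ ℝ (E := ℝ) with hL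
  have I1 : Integrable (ρ ⋆[L, volume] (fun x => |w x - g x|)) := hρi.integrable_convolution L hh.abs
  have hρc : HasCompactSupport ρ := b.hasCompactSupport_normed
  have hρcont : Continuous ρ := b.continuous_normed
  have ex : ∀ f : Rn n → ℝ, Integrable f → ConvolutionExists ρ f L volume := fun f hf =>
    hρc.convolutionExists_left L hρcont hf.locallyIntegrable
  have pt : ∀ x, |(ρ ⋆[L, volume] w) x - w x| ≤
      (ρ ⋆[L, volume] (fun x => |w x - g x|)) x + τ + |w x - g x| := by
    intro x
    have e1 : (ρ ⋆[L, volume] w) x = (ρ ⋆[L, volume] (fun x => w x - g x)) x + (ρ ⋆[L, volume] g) x := by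
      unfold convolution
      rw [← integral_add]
      · congr 1; ext t; simp [hL]; ring
      · exact ex _ hh x
      · exact ex _ gint x
    have e2 : |(ρ ⋆[L, volume] (fun x => w x - g x)) x| ≤ (ρ ⋆[L, volume] (fun x => |w x - g x|)) x := by
      unfold convolution
      refine (abs_integral_le_integral_abs).trans (le_of_eq ?_)
      congr 1; ext t
      simp only [hL, ContinuousLinearMap.lsmul_apply, smul_eq_mul, abs_mul]
      rw [abs_of_nonneg (b.nonneg_normed t)]
    have e3 : |(ρ ⋆[L, volume] g) x - g x| ≤ τ := by
      rw [← Real.dist_eq]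
      apply ContDiffBump.dist_normed_convolution_le gcont.aestronglyMeasurable
      intro y hy
      refine (hgδ ?_).le
      rw [Metric.mem_ball, hbr] at hy
      have := min_le_left δ ε
      linarith
    rw [e1]
    have : (ρ ⋆[L, volume] (fun x => w x - g x)) x + (ρ ⋆[L, volume] g) x - w x =
      (ρ ⋆[L, volume] (fun x => w x - g x)) x + ((ρ ⋆[L, volume] g) x - g x) + -(w x - g x) := by ring
    rw [this]
    refine (abs_add_three _ _ _).trans ?_
    rw [abs_neg]
    gcongr
  have hn1 : ∫ x, (ρ ⋆[L, volume] (fun x => |w x - g x|)) x = ∫ x, |w x - g x| := by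
    rw [integral_convolution L hρi hh.abs, b.integral_normed]
    simp [hL]
  have hn0 : ∀ x, 0 ≤ (ρ ⋆[L, volume] (fun x => |w x - g x|)) x := by
    intro x
    refine integral_nonneg fun t => ?_
    simp only [hL, ContinuousLinearMap.lsmul_apply, smul_eq_mul]
    exact mul_nonneg (b.nonneg_normed t) (abs_nonneg _)
  have : IsFiniteMeasure (volume.restrict A) := ⟨by simpa using hA.lt_top⟩
  calc _ ≤ ∫ x in A, ((ρ ⋆[L, volume] (fun x => |w x - g x|)) x + τ + |w x - g x|) := by
        refine integral_mono_of_nonneg (Eventually.of_forall fun _ => abs_nonneg _) ?_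
          (Eventually.of_forall pt)
        exact (I1.integrableOn.add (integrable_const τ)).add hh.abs.integrableOn
    _ = (∫ x in A, (ρ ⋆[L, volume] (fun x => |w x - g x|)) x) + V * τ + ∫ x in A, |w x - g x| := by
        have J1 : Integrable (fun x => (ρ ⋆[L, volume] (fun x => |w x - g x|)) x + τ)
          (volume.restrict A) := I1.integrableOn.add (integrable_const τ)
        have J2 : Integrable (fun x => |w x - g x|) (volume.restrict A) := hh.abs.integrableOn
        rw [integral_add J1 J2, integral_add I1.integrableOn (integrable_const τ)]
        simp [hV, Measure.real]
    _ ≤ κ / 3 + κ / 3 + κ / 3 := by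
        have a1 : ∫ x in A, |w x - g x| ≤ ∫ x, |w x - g x| :=
          setIntegral_le_integral hh.abs (Eventually.of_forall fun _ => abs_nonneg _)
        have a2 : ∫ x in A, (ρ ⋆[L, volume] (fun x => |w x - g x|)) x ≤ ∫ x, |w x - g x| :=
          (setIntegral_le_integral I1 (Eventually.of_forall hn0)).trans hn1.le
        have a3 : V * τ ≤ κ / 3 := by
          rw [hτ, mul_div_assoc', div_le_iff₀ (by positivity)]
          nlinarith
        have a4 : ∫ x, |w x - g x| ≤ κ / 3 := by simpa [Real.norm_eq_abs] using hg
        linarith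
    _ = κ := by ring

open scoped Convolution in
theorem moll_fubini {n : ℕ} {w D : Rn n → ℝ} (hw : Integrable w) (b : ContDiffBump (0 : Rn n))
    (hD : Continuous D) (hDc : HasCompactSupport D) :
    ∫ x, (b.normed volume ⋆[ContinuousLinearMap.lsmul ℝ ℝ, volume] w) x * D x
      = ∫ t, b.normed volume t * ∫ x, w x * D (x + t) := by
  set ρ := b.normed (volume : Measure (Rn n)) with hρ
  obtain ⟨C, hC⟩ := hDc.exists_bound_of_continuous hD
  have hρi : Integrable ρ := b.integrable_normed
  have hint : Integrable (fun z : Rn n × Rn n => ρ z.2 * w (z.1 - z.2) * D z.1)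
      (volume.prod volume) := by
    have h1 := hρi.convolution_integrand (ContinuousLinearMap.mul ℝ ℝ) hw (μ := volume) (ν := volume)
    have h1' : Integrable (fun z : Rn n × Rn n => ρ z.2 * w (z.1 - z.2)) (volume.prod volume) := by
      simpa using h1
    refine h1'.mul_bdd (c := C) (by fun_prop) (Eventually.of_forall fun z => hC _)
  have e1 : ∀ x, (ρ ⋆[ContinuousLinearMap.lsmul ℝ ℝ, volume] w) x * D x
      = ∫ t, ρ t * w (x - t) * D x := by
    intro x
    unfold convolution
    rw [← integral_mul_const]
    simp
  simp_rw [e1]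
  rw [integral_integral_swap hint]
  congr 1; ext t
  rw [← integral_const_mul, ← integral_sub_right_eq_self (fun x => ρ t * (w x * D (x + t))) t]
  congr 1; ext x
  simp [mul_assoc]

theorem softplus_exists (a δ : ℝ) (hδ : 0 < δ) : ∃ p p' : ℝ → ℝ, ContDiff ℝ 1 p ∧ ContDiff ℝ 1 p' ∧
    (∀ s, HasDerivAt p (p' s) s) ∧ (∀ s, 0 ≤ p' s ∧ p' s ≤ 1) ∧
    ∀ s, |p s - max (s - a) 0| ≤ δ := by
  have pos : ∀ s : ℝ, 0 < (s - a) ^ 2 + δ ^ 2 := fun s => by positivity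
  have hsq : ContDiff ℝ 1 (fun s : ℝ => Real.sqrt ((s - a) ^ 2 + δ ^ 2)) :=
    ContDiff.sqrt (by fun_prop) (fun s => (pos s).ne')
  have key : ∀ s : ℝ, |s - a| ≤ Real.sqrt ((s - a) ^ 2 + δ ^ 2) := fun s =>
    Real.abs_le_sqrt (by nlinarith)
  have key2 : ∀ s : ℝ, Real.sqrt ((s - a) ^ 2 + δ ^ 2) ≤ |s - a| + δ := fun s => by
    rw [Real.sqrt_le_left (by positivity)]
    nlinarith [sq_abs (s - a), abs_nonneg (s - a)]
  refine ⟨fun s => (s - a + Real.sqrt ((s - a) ^ 2 + δ ^ 2)) / 2,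
    fun s => (1 + (s - a) / Real.sqrt ((s - a) ^ 2 + δ ^ 2)) / 2, ?_, ?_, ?_, ?_, ?_⟩
  · exact (ContDiff.add (by fun_prop) hsq).div_const 2
  · exact (contDiff_const.add (ContDiff.div (by fun_prop) hsq
      (fun s => (Real.sqrt_pos.2 (pos s)).ne'))).div_const 2
  · intro s
    have h1 : HasDerivAt (fun s : ℝ => s - a) 1 s := (hasDerivAt_id s).sub_const a
    have h2 : HasDerivAt (fun s : ℝ => (s - a) ^ 2 + δ ^ 2) (2 * (s - a)) s := by
      simpa using (h1.pow 2).add_const (δ ^ 2)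
    have h3 := (h1.add (h2.sqrt (pos s).ne')).div_const 2
    refine h3.congr_deriv ?_
    have := (Real.sqrt_pos.2 (pos s)).ne'
    rw [mul_div_mul_left _ _ two_ne_zero]
  · intro s
    have h0 := Real.sqrt_pos.2 (pos s)
    have h1 : -1 ≤ (s - a) / Real.sqrt ((s - a) ^ 2 + δ ^ 2) := by
      rw [le_div_iff₀ h0]; linarith [neg_abs_le (s - a), key s]
    have h2 : (s - a) / Real.sqrt ((s - a) ^ 2 + δ ^ 2) ≤ 1 := by
      rw [div_le_iff₀ h0]; linarith [le_abs_self (s - a), key s]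
    constructor <;> linarith
  · intro s
    have h1 := key s
    have h2 := key2 s
    simp only
    rcases le_total 0 (s - a) with h | h
    · rw [max_eq_left h, abs_of_nonneg h] at *
      rw [abs_le]; constructor <;> linarith
    · rw [max_eq_right h]
      rw [abs_of_nonpos h] at *
      rw [abs_le]; constructor <;> linarith

theorem int_mul_div {n : ℕ} {A : Set (Rn n)} {w : Rn n → ℝ} (hw : IntegrableOn w A)
    {η : Rn n → Rn n} (h : ContDiff ℝ 1 η) (hc : HasCompactSupport η) :
    Integrable (fun x => w x * divN η x) (volume.restrict A) := by
  obtain ⟨C, _, hC⟩ := divN_bdd h hc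
  exact Integrable.mul_bdd (c := C) hw (divN_cont h).aestronglyMeasurable
    (Eventually.of_forall hC)

theorem testN_zero {n : ℕ} (A : Set (Rn n)) {ψ : Rn n → ℝ} (hψ : IsNormN ψ) :
    TestN A ψ (fun _ => 0) := by
  refine ⟨contDiff_const, HasCompactSupport.zero, by simp [tsupport], fun x => ?_⟩
  have := hψ.2.1 0 0
  simp at this
  simp [this]

theorem testN_neg {n : ℕ} {A : Set (Rn n)} {ψ : Rn n → ℝ} (hψ : IsNormN ψ) {η : Rn n → Rn n}
    (h : TestN A ψ η) : TestN A ψ (fun x => - η x) := by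
  refine ⟨h.1.neg, (HasCompactSupport.intro h.2.1 fun x hx => by
      rw [image_eq_zero_of_notMem_tsupport hx, neg_zero]), ?_, fun x => ?_⟩
  · have : tsupport (fun x => - η x) = tsupport η := by
      unfold tsupport; congr 1; ext x; simp
    rw [this]; exact h.2.2.1
  · have := hψ.2.1 (-1) (η x)
    simp at this
    rw [this]; exact h.2.2.2 x

theorem bound_nonneg {n : ℕ} {A : Set (Rn n)} {ψ : Rn n → ℝ} (hψ : IsNormN ψ) {w : Rn n → ℝ}
    {M : ℝ} (hM : ∀ η, TestN A ψ η → ∫ x in A, w x * divN η x ≤ M) : 0 ≤ M := by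
  have := hM _ (testN_zero A hψ)
  simpa [divN] using this

open scoped Convolution in
theorem moll_bound {n : ℕ} {A : Set (Rn n)} (hA : IsOpen A) {ψ : Rn n → ℝ}
    (hψ : IsNormN ψ) {w : Rn n → ℝ} (hw : IntegrableOn w A)
    {M : ℝ} (hM : ∀ η, TestN A ψ η → ∫ x in A, w x * divN η x ≤ M)
    {K : Set (Rn n)} (hK : IsCompact K) {ε : ℝ} (hKA : Metric.thickening ε K ⊆ A)
    (b : ContDiffBump (0 : Rn n)) (hb : b.rOut < ε)
    {X : Rn n → Rn n} (hX : ContDiff ℝ 1 X) (hXK : tsupport X ⊆ K) (hXψ : ∀ x, ψ (X x) ≤ 1) :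
    ∫ x, (b.normed volume ⋆[ContinuousLinearMap.lsmul ℝ ℝ, volume] (A.indicator w)) x * divN X x
      ≤ M := by
  have hXc : HasCompactSupport X := hK.of_isClosed_subset (isClosed_tsupport X) hXK
  rw [moll_fubini ((integrable_indicator_iff hA.measurableSet).2 hw) b (divN_cont hX) (divN_cs hXc)]
  have pt : ∀ t, b.normed volume t * ∫ x, A.indicator w x * divN X (x + t)
      ≤ b.normed volume t * M := by
    intro t
    by_cases ht : t ∈ Function.support (b.normed (volume : Measure (Rn n)))
    · refine mul_le_mul_of_nonneg_left ?_ (b.nonneg_normed t)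
      rw [b.support_normed_eq, mem_ball_zero_iff] at ht
      have hXt : TestN A ψ (fun y => X (y + t)) := by
        have hs : tsupport (fun y => X (y + t)) ⊆ (fun y => y + t) ⁻¹' (tsupport X) :=
          tsupport_comp_subset_preimage X (by fun_prop)
        refine ⟨hX.comp (contDiff_id.add contDiff_const), ?_, ?_, fun x => hXψ _⟩
        · exact hXc.comp_homeomorph (Homeomorph.addRight t)
        · refine hs.trans fun y hy => hKA ?_
          rw [Metric.mem_thickening_iff]
          refine ⟨y + t, hXK hy, ?_⟩
          simp; linarith
      have := hM _ hXt
      simp_rw [divN_translate] at this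
      rw [← integral_indicator hA.measurableSet] at this
      refine le_trans (le_of_eq (integral_congr_ae (Eventually.of_forall fun x => ?_))) this
      by_cases hx : x ∈ A <;> simp [hx]
    · rw [Function.notMem_support.1 ht]; simp
  by_cases hi : Integrable (fun t => b.normed volume t * ∫ x, A.indicator w x * divN X (x + t))
  · refine (integral_mono hi (b.integrable_normed.mul_const M) pt).trans ?_
    rw [integral_mul_const, b.integral_normed]; simp
  · rw [integral_undef hi]; exact bound_nonneg hψ hM

open scoped Convolution in
theorem trunc_ineq {n : ℕ} {A : Set (Rn n)} (hA : IsOpen A) (hAf : volume A ≠ ⊤) {ψ : Rn n → ℝ}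
    (hψ : IsNormN ψ) {w : Rn n → ℝ} (hw : IntegrableOn w A)
    {M : ℝ} (hM : ∀ η, TestN A ψ η → ∫ x in A, w x * divN η x ≤ M)
    {η ζ : Rn n → Rn n} (hη : TestN A ψ η) (hζ : TestN A ψ ζ) (a : ℝ) :
    (∫ x in A, min (w x) a * divN η x) + ∫ x in A, max (w x - a) 0 * divN ζ x ≤ M := by
  refine le_of_forall_pos_le_add fun κ hκ => ?_
  obtain ⟨C₁, h₁, hC₁⟩ := divN_bdd hη.1 hη.2.1
  obtain ⟨C₂, h₂, hC₂⟩ := divN_bdd hζ.1 hζ.2.1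
  set V := (volume A).toReal with hV
  have hV0 : 0 ≤ V := ENNReal.toReal_nonneg
  set δ := κ / ((C₁ + C₂ + 1) * (1 + V)) with hδdef
  have hδ : 0 < δ := by positivity
  have hfin : IsFiniteMeasure (volume.restrict A) := ⟨by simpa using hAf.lt_top⟩
  set K := tsupport η ∪ tsupport ζ with hKdef
  have hK : IsCompact K := hη.2.1.isCompact.union hζ.2.1.isCompact
  obtain ⟨ε, hε, hKA⟩ := hK.exists_thickening_subset_open hA (union_subset hη.2.2.1 hζ.2.2.1)
  have hwi : Integrable (A.indicator w) := (integrable_indicator_iff hA.measurableSet).2 hw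
  obtain ⟨b, hb, hbL⟩ := moll_L1 hAf hwi hε hδ
  obtain ⟨p, p', hp, hp', hd, hp01, hpa⟩ := softplus_exists a δ hδ
  set f := (b.normed volume ⋆[ContinuousLinearMap.lsmul ℝ ℝ, volume] (A.indicator w)) with hf
  have hfc : ContDiff ℝ 1 f :=
    b.hasCompactSupport_normed.contDiff_convolution_left _ b.contDiff_normed hwi.locallyIntegrable
  have hq' : ContDiff ℝ 1 (fun y => p' (f y)) := hp'.comp hfc
  have hid := ibp_identity hfc hp hp' hd hη.1 hη.2.1 hζ.1 hζ.2.1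
  have hXd : ContDiff ℝ 1 (fun y => (1 - p' (f y)) • η y + p' (f y) • ζ y) :=
    ((contDiff_const.sub hq').smul hη.1).add (hq'.smul hζ.1)
  have hbd := moll_bound hA hψ hw hM hK hKA b hb hXd (by
      refine closure_minimal ?_ hK.isClosed
      intro x hx
      by_contra hxK
      rw [hKdef, mem_union, not_or] at hxK
      apply hx
      simp only
      rw [image_eq_zero_of_notMem_tsupport hxK.1, image_eq_zero_of_notMem_tsupport hxK.2]
      simp) (by
      intro x
      have hh := hp01 (f x)
      have := hψ.1.2 (mem_univ (η x)) (mem_univ (ζ x)) (show 0 ≤ 1 - p' (f x) by linarith)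
        hh.1 (by ring)
      refine this.trans ?_
      simp only [smul_eq_mul]
      nlinarith [hη.2.2.2 x, hζ.2.2.2 x])
  rw [← hf, hid] at hbd
  have hset : ∫ x, ((f x - p (f x)) * divN η x + p (f x) * divN ζ x)
      = ∫ x in A, ((f x - p (f x)) * divN η x + p (f x) * divN ζ x) := by
    rw [setIntegral_eq_integral_of_forall_compl_eq_zero]
    intro x hx
    rw [divN_zero_of (fun h => hx (hη.2.2.1 h)), divN_zero_of (fun h => hx (hζ.2.2.1 h))]
    simp
  have hint : Integrable (fun x => (f x - p (f x)) * divN η x + p (f x) * divN ζ x)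
      (volume.restrict A) := by
    refine Integrable.integrableOn (Integrable.add ?_ ?_)
    · exact ((hfc.continuous.sub (hp.continuous.comp hfc.continuous)).mul
        (divN_cont hη.1)).integrable_of_hasCompactSupport
        (HasCompactSupport.mul_left (divN_cs hη.2.1))
    · exact ((hp.continuous.comp hfc.continuous).mul
        (divN_cont hζ.1)).integrable_of_hasCompactSupport
        (HasCompactSupport.mul_left (divN_cs hζ.2.1))
  have i1 : Integrable (fun x => min (w x) a * divN η x) (volume.restrict A) :=
    int_mul_div (Integrable.inf hw (integrable_const a)) hη.1 hη.2.1
  have i2 : Integrable (fun x => max (w x - a) 0 * divN ζ x) (volume.restrict A) :=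
    int_mul_div (Integrable.pos_part (Integrable.sub hw (integrable_const a))) hζ.1 hζ.2.1
  have hfi : Integrable (fun x => |f x - A.indicator w x|) (volume.restrict A) := by
    have : Integrable f := b.integrable_normed.integrable_convolution _ hwi
    exact (this.sub hwi).abs.integrableOn
  have i3 : Integrable (fun x => (C₁ + C₂) * (|f x - A.indicator w x| + δ)) (volume.restrict A) :=
    (hfi.add (integrable_const δ)).const_mul _
  rw [← integral_add i1 i2]
  have cmp : ∫ x in A, (min (w x) a * divN η x + max (w x - a) 0 * divN ζ x) ≤
      ∫ x in A, (((f x - p (f x)) * divN η x + p (f x) * divN ζ x)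
        + (C₁ + C₂) * (|f x - A.indicator w x| + δ)) := by
    refine setIntegral_mono_on (i1.add i2) (hint.add i3) hA.measurableSet fun x hx => ?_
    rw [indicator_of_mem hx]
    have e1 : |max (w x - a) 0 - p (f x)| ≤ |f x - w x| + δ := by
      have t1 := abs_max_sub_max_le_abs (w x - a) (f x - a) 0
      have t2 := hpa (f x)
      rw [show w x - a - (f x - a) = -(f x - w x) by ring, abs_neg] at t1
      rw [abs_sub_comm] at t2
      calc _ = |(max (w x - a) 0 - max (f x - a) 0) + (max (f x - a) 0 - p (f x))| := by ring_nf
        _ ≤ _ := (abs_add_le _ _).trans (add_le_add t1 t2)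
    have e2 : |min (w x) a - (f x - p (f x))| ≤ |f x - w x| + δ := by
      have t1 : |min (w x) a - min (f x) a| ≤ |f x - w x| := by
        have := abs_min_sub_min_le_max (w x) a (f x) a
        rwa [sub_self, abs_zero, max_eq_left (abs_nonneg _), abs_sub_comm (w x)] at this
      have t2 := hpa (f x)
      have t3 : min (f x) a = f x - max (f x - a) 0 := by
        rcases le_total (f x) a with h | h
        · rw [min_eq_left h, max_eq_right (by linarith)]; ring
        · rw [min_eq_right h, max_eq_left (by linarith)]; ring
      calc _ = |(min (w x) a - min (f x) a) + (p (f x) - max (f x - a) 0)| := by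
            rw [t3]; ring_nf
        _ ≤ _ := (abs_add_le _ _).trans (add_le_add t1 t2)
    have m1 : (min (w x) a - (f x - p (f x))) * divN η x ≤ (|f x - w x| + δ) * C₁ := by
      refine (le_abs_self _).trans ?_
      rw [abs_mul]
      exact mul_le_mul e2 (hC₁ x) (abs_nonneg _) (by positivity)
    have m2 : (max (w x - a) 0 - p (f x)) * divN ζ x ≤ (|f x - w x| + δ) * C₂ := by
      refine (le_abs_self _).trans ?_
      rw [abs_mul]
      exact mul_le_mul e1 (hC₂ x) (abs_nonneg _) (by positivity)
    nlinarith
  have J : ∫ x in A, (|f x - A.indicator w x| + δ) = (∫ x in A, |f x - A.indicator w x|) + V * δ := by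
    rw [integral_add hfi (integrable_const δ)]
    simp [hV, Measure.real]
  rw [integral_add hint i3, integral_const_mul, J, ← hset] at cmp
  have fin1 : (C₁ + C₂) * ((∫ x in A, |f x - A.indicator w x|) + V * δ) ≤ (C₁ + C₂) * (δ + V * δ) := by
    gcongr
  have fin2 : (C₁ + C₂) * (δ + V * δ) ≤ κ := by
    have : (C₁ + C₂ + 1) * (1 + V) * δ = κ := by
      rw [hδdef]; field_simp
    nlinarith [mul_nonneg hV0 hδ.le]
  linarith

theorem mono_diff {m : ℝ → ℝ} (hm : Monotone m) {M h : ℝ} (h0 : ∀ t, 0 ≤ m t) (hM : ∀ t, m t ≤ M)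
    (hh : 0 < h) :
    ∫⁻ l, ENNReal.ofReal (h⁻¹ * (m (l + h) - m l)) ≤ ENNReal.ofReal M := by
  have hii : ∀ a b, IntervalIntegrable m volume a b := fun a b => hm.intervalIntegrable
  have hm' : Monotone (fun l => m (l + h)) := fun x y hxy => hm (by linarith)
  have hii' : ∀ a b, IntervalIntegrable (fun l => m (l + h)) volume a b :=
    fun a b => hm'.intervalIntegrable
  have hU : (⋃ k : ℕ, Ioc (-(k:ℝ)) k) = univ := by
    refine eq_univ_of_forall fun x => mem_iUnion.2 ?_
    obtain ⟨k, hk⟩ := exists_nat_gt |x|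
    exact ⟨k, by linarith [neg_abs_le x], by linarith [le_abs_self x]⟩
  have hdir : Directed (· ⊆ ·) (fun k : ℕ => Ioc (-(k:ℝ)) k) := by
    refine (monotone_nat_of_le_succ fun k => ?_).directed_le
    apply Ioc_subset_Ioc <;> push_cast <;> linarith
  rw [← setLIntegral_univ, ← hU, setLIntegral_iUnion_of_directed _ hdir]
  refine iSup_le fun k => ?_
  have hk : -(k:ℝ) ≤ k := by have : (0:ℝ) ≤ k := k.cast_nonneg; linarith
  have hi : IntervalIntegrable (fun l => h⁻¹ * (m (l + h) - m l)) volume (-(k:ℝ)) k :=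
    ((hii' _ _).sub (hii _ _)).const_mul _
  rw [← ofReal_integral_eq_lintegral_ofReal ((intervalIntegrable_iff_integrableOn_Ioc_of_le hk).1 hi)
    (Eventually.of_forall fun l => mul_nonneg (by positivity) (sub_nonneg.2 (hm (by linarith))))]
  apply ENNReal.ofReal_le_ofReal
  rw [← intervalIntegral.integral_of_le hk, intervalIntegral.integral_const_mul,
    intervalIntegral.integral_sub (hii' _ _) (hii _ _), intervalIntegral.integral_comp_add_right]
  have e := intervalIntegral.integral_interval_sub_interval_comm (hii (-(k:ℝ) + h) (k + h))
    (hii (-(k:ℝ)) k) (hii _ _)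
  rw [e]
  have b1 : 0 ≤ ∫ x in (-(k:ℝ))..(-(k:ℝ) + h), m x :=
    intervalIntegral.integral_nonneg (by linarith) fun x _ => h0 x
  have b2 : ∫ x in (k:ℝ)..(k + h), m x ≤ h * M := by
    have := intervalIntegral.integral_mono_on (μ := volume) (f := m) (g := fun _ => M)
      (show (k:ℝ) ≤ k + h by linarith) (hii _ _) (by simp) (fun x _ => hM x)
    simpa using this
  rw [inv_mul_le_iff₀ hh]
  rw [intervalIntegral.integral_symm (-(k:ℝ)) , intervalIntegral.integral_symm (k:ℝ)]
  linarith

theorem coarea_hard {n : ℕ} {A : Set (Rn n)} (hA : IsOpen A) (hAf : volume A ≠ ⊤) {ψ : Rn n → ℝ}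
    (hψ : IsNormN ψ) {v : Rn n → ℝ} (hv : IntegrableOn v A)
    {M : ℝ} (hM : ∀ η, TestN A ψ η → ∫ x in A, v x * divN η x ≤ M) :
    ∃ L : ℝ → ENNReal, Measurable L ∧ ∫⁻ l, L l ≤ ENNReal.ofReal M ∧
      ∀ l η, TestN A ψ η →
        ENNReal.ofReal (∫ x in A, {x | l < v x}.indicator (divN η) x) ≤ L l := by
  have hfin : IsFiniteMeasure (volume.restrict A) := ⟨by simpa using hAf.lt_top⟩
  set S : ℝ → Set ℝ := fun t => {r | ∃ η, TestN A ψ η ∧ r = ∫ x in A, min (v x) t * divN η x}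
    with hS
  set m : ℝ → ℝ := fun t => sSup (S t) with hm
  have hz : ∀ w : Rn n → ℝ, ∫ x in A, w x * divN (fun _ : Rn n => (0 : Rn n)) x = 0 := by
    intro w; simp [divN]
  have hne : ∀ t, (0:ℝ) ∈ S t := fun t => ⟨_, testN_zero A hψ, (hz _).symm⟩
  have hle : ∀ t, ∀ r ∈ S t, r ≤ M := by
    rintro t r ⟨η, hη, rfl⟩
    have := trunc_ineq hA hAf hψ hv hM hη (testN_zero A hψ) t
    rwa [hz, add_zero] at this
  have hbdd : ∀ t, BddAbove (S t) := fun t => ⟨M, fun r hr => hle t r hr⟩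
  have hm0 : ∀ t, 0 ≤ m t := fun t => le_csSup (hbdd t) (hne t)
  have hmM : ∀ t, m t ≤ M := fun t => csSup_le ⟨0, hne t⟩ (hle t)
  have sup : ∀ s t, s ≤ t → ∀ ζ, TestN A ψ ζ →
      ∫ x in A, max (min (v x) t - s) 0 * divN ζ x ≤ m t - m s := by
    intro s t hst ζ hζ
    rw [le_sub_iff_add_le, add_comm, ← le_sub_iff_add_le]
    refine csSup_le ⟨0, hne s⟩ ?_
    rintro r ⟨η, hη, rfl⟩
    rw [le_sub_iff_add_le]
    have := trunc_ineq hA hAf hψ (w := fun x => min (v x) t) (M := m t)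
      (Integrable.inf hv (integrable_const t))
      (fun η hη => le_csSup (hbdd t) ⟨η, hη, rfl⟩) hη hζ s
    simpa only [min_assoc, min_eq_right hst] using this
  have hmono : Monotone m := by
    intro s t hst
    have := sup s t hst _ (testN_zero A hψ)
    rw [hz] at this
    linarith
  set h : ℕ → ℝ := fun k => 1 / ((k:ℝ) + 1) with hh
  have hpos : ∀ k, 0 < h k := fun k => by positivity
  have hlim : Tendsto h atTop (nhds 0) := tendsto_one_div_add_atTop_nhds_zero_nat
  have hmeas : ∀ k, Measurable (fun l => ENNReal.ofReal ((h k)⁻¹ * (m (l + h k) - m l))) := by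
    intro k
    have h1 : Measurable (fun l => m (l + h k)) := hmono.measurable.comp (by fun_prop)
    exact ((h1.sub hmono.measurable).const_mul _).ennreal_ofReal
  refine ⟨fun l => liminf (fun k => ENNReal.ofReal ((h k)⁻¹ * (m (l + h k) - m l))) atTop,
    Measurable.liminf hmeas, ?_, ?_⟩
  · refine (lintegral_liminf_le hmeas).trans ?_
    refine liminf_le_of_frequently_le' (Frequently.of_forall fun k => ?_)
    exact mono_diff hmono hm0 hmM (hpos k)
  · intro l ζ hζ
    obtain ⟨C, hC0, hC⟩ := divN_bdd hζ.1 hζ.2.1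
    have ht : Tendsto (fun k => ∫ x in A, ((h k)⁻¹ * max (min (v x) (l + h k) - l) 0) * divN ζ x)
        atTop (nhds (∫ x in A, {x | l < v x}.indicator (divN ζ) x)) := by
      refine tendsto_integral_of_dominated_convergence (fun _ => C) ?_ (integrable_const C) ?_ ?_
      · intro k
        have : AEStronglyMeasurable v (volume.restrict A) := hv.aestronglyMeasurable
        have h2 : AEStronglyMeasurable (fun x => max (min (v x) (l + h k) - l) 0)
            (volume.restrict A) :=
          ((this.inf aestronglyMeasurable_const).sub aestronglyMeasurable_const).sup
            aestronglyMeasurable_const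
        exact (h2.const_mul _).mul (divN_cont hζ.1).aestronglyMeasurable
      · intro k
        refine Eventually.of_forall fun x => ?_
        rw [Real.norm_eq_abs, abs_mul]
        have a1 : 0 ≤ max (min (v x) (l + h k) - l) 0 := le_max_right _ _
        have a2 : max (min (v x) (l + h k) - l) 0 ≤ h k := by
          refine max_le ?_ (hpos k).le
          linarith [min_le_right (v x) (l + h k)]
        have a3 : |(h k)⁻¹ * max (min (v x) (l + h k) - l) 0| ≤ 1 := by
          rw [abs_of_nonneg (mul_nonneg (inv_nonneg.2 (hpos k).le) a1), inv_mul_le_iff₀ (hpos k)]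
          linarith
        calc _ ≤ 1 * C := mul_le_mul a3 (hC x) (abs_nonneg _) zero_le_one
          _ = C := one_mul C
      · refine Eventually.of_forall fun x => ?_
        by_cases hx : l < v x
        · rw [indicator_of_mem (by exact hx)]
          refine tendsto_const_nhds.congr' ?_
          filter_upwards [hlim.eventually (gt_mem_nhds (show 0 < v x - l by linarith))] with k hk
          rw [min_eq_right (by linarith), add_sub_cancel_left, max_eq_left (hpos k).le,
            inv_mul_cancel₀ (hpos k).ne', one_mul]
        · rw [indicator_of_notMem (by exact hx)]
          refine tendsto_const_nhds.congr fun k => ?_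
          rw [max_eq_right, mul_zero, zero_mul]
          linarith [min_le_left (v x) (l + h k), not_lt.1 hx]
    have ht' := (ENNReal.continuous_ofReal.tendsto _).comp ht
    rw [← ht'.liminf_eq]
    refine liminf_le_liminf (Eventually.of_forall fun k => ?_)
    apply ENNReal.ofReal_le_ofReal
    simp_rw [mul_assoc]
    rw [integral_const_mul]
    exact mul_le_mul_of_nonneg_left (sup l (l + h k) (by linarith [hpos k]) ζ hζ)
      (inv_nonneg.2 (hpos k).le)

theorem layer_cake {n : ℕ} {A : Set (Rn n)} (hAf : volume A ≠ ⊤) {u D : Rn n → ℝ}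
    (hu : IntegrableOn u A) (hD : Continuous D) {C : ℝ} (hC : ∀ x, |D x| ≤ C)
    (hD0 : ∫ x in A, D x = 0) :
    Integrable (fun l : ℝ => ∫ x in A, {x | l < u x}.indicator D x) ∧
      ∫ x in A, u x * D x = ∫ l : ℝ, ∫ x in A, {x | l < u x}.indicator D x := by
  have hfin : IsFiniteMeasure (volume.restrict A) := ⟨by simpa using hAf.lt_top⟩
  set μ := volume.restrict A with hμ
  obtain ⟨u', hu'm, huu'⟩ := hu.aestronglyMeasurable
  have hu' : Integrable u' μ := hu.congr huu'
  have hDi : Integrable D μ := Integrable.of_bound hD.aestronglyMeasurable C (Eventually.of_forall hC)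
  let k : Rn n → ℝ → ℝ := fun x l => (if l < u' x then 1 else 0) - (if l < 0 then 1 else 0)
  have hk1 : ∀ x, Integrable (k x) ∧ ∫ l, |k x l| = |u' x| ∧ ∫ l, k x l = u' x := by
    intro x
    rcases le_total 0 (u' x) with h | h
    · have e : k x = (Ico 0 (u' x)).indicator (fun _ => (1:ℝ)) := by
        ext l
        simp only [k, indicator, mem_Ico]
        split_ifs <;> first | (exfalso; grind) | norm_num
      have e' : (fun l => |k x l|) = (Ico 0 (u' x)).indicator (fun _ => (1:ℝ)) := by
        rw [e]; ext l; simp only [indicator]; split_ifs <;> simp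
      refine ⟨?_, ?_, ?_⟩
      · rw [e, integrable_indicator_iff measurableSet_Ico]
        exact integrableOn_const (by simp)
      · rw [e', integral_indicator measurableSet_Ico, abs_of_nonneg h]; simp [h]
      · rw [e, integral_indicator measurableSet_Ico]; simp [h]
    · have e : k x = (Ico (u' x) 0).indicator (fun _ => (-1:ℝ)) := by
        ext l
        simp only [k, indicator, mem_Ico]
        split_ifs <;> first | (exfalso; grind) | norm_num
      have e' : (fun l => |k x l|) = (Ico (u' x) 0).indicator (fun _ => (1:ℝ)) := by
        rw [e]; ext l; simp only [indicator]; split_ifs <;> simp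
      refine ⟨?_, ?_, ?_⟩
      · rw [e, integrable_indicator_iff measurableSet_Ico]
        exact integrableOn_const (by simp)
      · rw [e', integral_indicator measurableSet_Ico, abs_of_nonpos h]; simp [h]
      · rw [e, integral_indicator measurableSet_Ico]; simp [h]
  have hkm : Measurable (fun z : Rn n × ℝ => k z.1 z.2) := by
    refine Measurable.sub (Measurable.ite ?_ measurable_const measurable_const)
      (Measurable.ite ?_ measurable_const measurable_const)
    · exact measurableSet_lt measurable_snd (hu'm.measurable.comp measurable_fst)
    · exact measurableSet_lt measurable_snd measurable_const
  have hint : Integrable (Function.uncurry fun x l => k x l * D x) (μ.prod volume) := by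
    rw [integrable_prod_iff]
    · refine ⟨Eventually.of_forall fun x => (hk1 x).1.mul_const (D x), ?_⟩
      simp only [Function.uncurry, norm_mul, Real.norm_eq_abs]
      simp_rw [integral_mul_const, fun x => (hk1 x).2.1]
      exact hu'.abs.mul_bdd (c := C) hD.abs.aestronglyMeasurable
        (Eventually.of_forall fun x => by simpa using hC x)
    · exact (hkm.mul (hD.measurable.comp measurable_fst)).aestronglyMeasurable
  have hg : ∀ l : ℝ, ∫ x, k x l * D x ∂μ = ∫ x, {x | l < u x}.indicator D x ∂μ := by
    intro l
    have hm : MeasurableSet {x | l < u' x} := measurableSet_lt measurable_const hu'm.measurable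
    have e1 : ∫ x, {x | l < u x}.indicator D x ∂μ = ∫ x, {x | l < u' x}.indicator D x ∂μ := by
      refine integral_congr_ae ?_
      filter_upwards [huu'] with x hx
      simp only [indicator, mem_ofPred_eq, hx]
    have e2 : ∀ x, k x l * D x = {x | l < u' x}.indicator D x - (if l < 0 then 1 else 0) * D x := by
      intro x
      simp only [k, indicator, mem_ofPred_eq]
      split_ifs <;> ring
    simp_rw [e1, e2]
    rw [integral_sub (hDi.indicator hm) (hDi.const_mul _), integral_const_mul, hD0]
    simp
  have e0 : ∫ x, u x * D x ∂μ = ∫ x, (∫ l, k x l * D x) ∂μ := by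
    refine integral_congr_ae ?_
    filter_upwards [huu'] with x hx
    rw [integral_mul_const, (hk1 x).2.2, hx]
  have hi2 := hint.integral_prod_right
  simp only [Function.uncurry] at hi2
  simp_rw [hg] at hi2
  refine ⟨hi2, ?_⟩
  rw [e0, integral_integral_swap hint]
  simp_rw [hg]

theorem setint_level {n : ℕ} {A Ω : Set (Rn n)} (hA : IsOpen A) (hAΩ : A ⊆ Ω) {v : Rn n → ℝ}
    (hv : IntegrableOn v A) {η : Rn n → Rn n} (hη : tsupport η ⊆ A) (l : ℝ) :
    ∫ x in {x ∈ Ω | l < v x}, divN η x = ∫ x in A, {x | l < v x}.indicator (divN η) x := by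
  have h0 : NullMeasurableSet {x | l < v x} (volume.restrict A) :=
    nullMeasurableSet_lt aemeasurable_const hv.aestronglyMeasurable.aemeasurable
  have e1 : divN η = A.indicator (divN η) := by
    ext x
    by_cases hx : x ∈ A
    · rw [indicator_of_mem hx]
    · rw [indicator_of_notMem hx, divN_zero_of (fun h => hx (hη h))]
  rw [integral_indicator₀ h0, Measure.restrict_restrict₀ h0]
  conv_lhs => rw [e1]
  rw [integral_indicator hA.measurableSet, Measure.restrict_restrict hA.measurableSet]
  congr 2
  ext x
  constructor
  · rintro ⟨h1, h2⟩; exact ⟨h2.2, h1⟩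
  · rintro ⟨h1, h2⟩; exact ⟨h2, hAΩ h2, h1⟩

theorem isNormN_norm (n : ℕ) : IsNormN (fun x : Rn n => ‖x‖) :=
  ⟨convexOn_univ_norm, fun c ξ => by simp only [norm_smul, Real.norm_eq_abs], 1, one_pos,
    fun ξ => by simp⟩

theorem testN_scale {n : ℕ} {φ : Rn n → ℝ} (hφ : IsNormN φ) : ∃ c > (0:ℝ), ∀ A η, TestN A φ η →
    TestN A (fun x => ‖x‖) (fun x => c • η x) := by
  obtain ⟨c, hc, h⟩ := hφ.2.2
  refine ⟨c, hc, fun A η hη => ⟨hη.1.const_smul c, cs_smul _ hη.2.1, ?_, fun x => ?_⟩⟩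
  · refine (closure_mono ?_).trans hη.2.2.1
    intro x hx hx'
    exact hx (by simp [hx'])
  · simp only
    rw [norm_smul, Real.norm_of_nonneg hc.le]
    exact (h _).trans (hη.2.2.2 x)

theorem exhaustion {n : ℕ} {Ω : Set (Rn n)} (hΩ : IsOpen Ω) : ∃ B : ℕ → Set (Rn n),
    (∀ j, CpCtd (B j) Ω) ∧ ∀ A, CpCtd A Ω → ∃ j, A ⊆ B j := by
  let d : Rn n → ENNReal := fun x => Metric.infEDist x Ωᶜ
  have hd : Continuous d := Metric.continuous_infEDist
  let B : ℕ → Set (Rn n) := fun j => Metric.ball 0 j ∩ {x | ((j : ENNReal) + 1)⁻¹ < d x}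
  have hBo : ∀ j, IsOpen (B j) := fun j =>
    Metric.isOpen_ball.inter (isOpen_lt continuous_const hd)
  have hcl : ∀ j, closure (B j) ⊆ Metric.closedBall 0 j ∩ {x | ((j : ENNReal) + 1)⁻¹ ≤ d x} := by
    intro j
    refine closure_minimal ?_ (Metric.isClosed_closedBall.inter (isClosed_le continuous_const hd))
    exact inter_subset_inter Metric.ball_subset_closedBall fun x hx => by
      simp only [mem_ofPred_eq] at hx ⊢; exact hx.le
  have hmono : Monotone B := by
    intro i j hij
    refine inter_subset_inter (Metric.ball_subset_ball (by exact_mod_cast hij)) fun x hx => ?_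
    simp only [mem_ofPred_eq] at hx ⊢
    refine lt_of_le_of_lt ?_ hx
    gcongr
  refine ⟨B, fun j => ⟨hBo j, ?_, ?_⟩, ?_⟩
  · exact (isCompact_closedBall _ _).of_isClosed_subset isClosed_closure
      ((hcl j).trans inter_subset_left)
  · intro x hx
    by_contra hxΩ
    have h1 := ((hcl j) hx).2
    have h2 : d x = 0 := Metric.infEDist_zero_of_mem hxΩ
    have h3 : ((j : ENNReal) + 1)⁻¹ ≤ d x := h1
    rw [h2] at h3
    simp at h3
  · intro A hA
    have hcov : closure A ⊆ ⋃ j, B j := by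
      intro x hx
      have hxΩ := hA.2.2 hx
      have hdx : 0 < d x := by
        rw [pos_iff_ne_zero]
        intro h
        have := (Metric.mem_iff_infEDist_zero_of_closed hΩ.isClosed_compl).2 h
        exact this hxΩ
      obtain ⟨i, hi⟩ := exists_nat_gt ‖x‖
      obtain ⟨k, hk⟩ := ENNReal.exists_inv_nat_lt hdx.ne'
      refine mem_iUnion.2 ⟨max i k, ?_, ?_⟩
      · rw [mem_ball_zero_iff]
        exact hi.trans_le (by exact_mod_cast le_max_left i k)
      · refine lt_of_le_of_lt ?_ hk
        rw [ENNReal.inv_le_inv]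
        exact le_trans (by exact_mod_cast le_max_right i k) le_self_add
    obtain ⟨j, hj⟩ := hA.2.1.elim_directed_cover B hBo hcov hmono.directed_le
    exact ⟨j, subset_closure.trans hj⟩

theorem CpCtd.vol {n : ℕ} {A Ω : Set (Rn n)} (h : CpCtd A Ω) : volume A ≠ ⊤ :=
  ((measure_mono subset_closure).trans_lt h.2.1.measure_lt_top).ne

theorem CpCtd.sub {n : ℕ} {A Ω : Set (Rn n)} (h : CpCtd A Ω) : A ⊆ Ω :=
  subset_closure.trans h.2.2

theorem level_bv {n : ℕ} {Ω : Set (Rn n)} (hΩ : IsOpen Ω) {v : Rn n → ℝ} (hv : BVlocFun Ω v) :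
    ∀ᵐ l ∂(volume : Measure ℝ), BVlocSetN Ω {x ∈ Ω | l < v x} := by
  obtain ⟨B, hB, hBA⟩ := exhaustion hΩ
  have h1 : ∀ j, ∃ L : ℝ → ENNReal, Measurable L ∧ ∫⁻ l, L l ≠ ⊤ ∧
      ∀ l η, TestN (B j) (fun x => ‖x‖) η →
        ENNReal.ofReal (∫ x in B j, {x | l < v x}.indicator (divN η) x) ≤ L l := by
    intro j
    obtain ⟨M, hM⟩ := hv.2 _ (hB j)
    obtain ⟨L, h1, h2, h3⟩ := coarea_hard (hB j).1 (hB j).vol (isNormN_norm n) (hv.1 _ (hB j))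
      (M := M) (fun η hη => hM ⟨η, hη, rfl⟩)
    exact ⟨L, h1, (h2.trans_lt ENNReal.ofReal_lt_top).ne, h3⟩
  choose L hL1 hL2 hL3 using h1
  have h2 : ∀ᵐ l ∂(volume : Measure ℝ), ∀ j, L j l < ⊤ :=
    ae_all_iff.2 fun j => ae_lt_top (hL1 j) (hL2 j)
  filter_upwards [h2] with l hl A hA
  obtain ⟨j, hj⟩ := hBA A hA
  refine ⟨(L j l).toReal, ?_⟩
  rintro r ⟨η, hη, rfl⟩
  have hη' : TestN (B j) (fun x => ‖x‖) η := ⟨hη.1, hη.2.1, hη.2.2.1.trans hj, hη.2.2.2⟩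
  have hn := testN_neg (isNormN_norm n) hη'
  have h3 := hL3 j l _ hn
  rw [← setint_level (hB j).1 (hB j).sub (hv.1 _ (hB j)) hn.2.2.1] at h3
  simp_rw [divN_neg'] at h3
  rw [integral_neg] at h3
  rwa [ENNReal.ofReal_le_iff_le_toReal (hl j).ne] at h3

theorem main_ineq {n : ℕ} {φ : Rn n → ℝ} (hφ : IsNormN φ)
    {Ω : Set (Rn n)} (hΩ : IsOpen Ω) {u : Rn n → ℝ} (hu : BVlocFun Ω u)
    (hlev : ∀ᵐ l ∂(volume : Measure ℝ), MinPerN φ Ω {x ∈ Ω | l < u x})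
    {A : Set (Rn n)} (hA : CpCtd A Ω) {v : Rn n → ℝ} (hv : BVlocFun Ω v)
    (hs : CptSupp A (fun x => u x - v x)) {M : ℝ}
    (hM : ∀ ζ, TestN A φ ζ → ∫ x in A, v x * divN ζ x ≤ M)
    {η : Rn n → Rn n} (hη : TestN A φ η) : ∫ x in A, u x * divN η x ≤ M := by
  obtain ⟨L, hL1, hL2, hL3⟩ := coarea_hard hA.1 hA.vol hφ (hv.1 A hA) hM
  obtain ⟨C, _, hC⟩ := divN_bdd hη.1 hη.2.1
  have hD0 : ∫ x in A, divN η x = 0 := by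
    rw [setIntegral_eq_integral_of_forall_compl_eq_zero, divN_integral hη.1 hη.2.1]
    intro x hx
    exact divN_zero_of fun h => hx (hη.2.2.1 h)
  obtain ⟨gi, ge⟩ := layer_cake hA.vol (hu.1 A hA) (divN_cont hη.1) hC hD0
  obtain ⟨c, hc, hsc⟩ := testN_scale hφ
  have pt : ∀ᵐ l ∂(volume : Measure ℝ),
      ENNReal.ofReal (∫ x in A, {x | l < u x}.indicator (divN η) x) ≤ L l := by
    filter_upwards [hlev, level_bv hΩ hv] with l hl hF
    by_cases hLt : L l = ⊤
    · rw [hLt]; exact le_top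
    rw [ENNReal.ofReal_le_iff_le_toReal hLt]
    have hsub : symmDiff {x ∈ Ω | l < u x} {x ∈ Ω | l < v x} ⊆
        Function.support (fun x => u x - v x) := by
      intro x hx h0
      have h1 : u x = v x := sub_eq_zero.1 h0
      rcases hx with ⟨⟨h2, h3⟩, h4⟩ | ⟨⟨h2, h3⟩, h4⟩
      · exact h4 ⟨h2, h1 ▸ h3⟩
      · exact h4 ⟨h2, h1 ▸ h3⟩
    have hcs := closure_mono hsub
    have hmin := hl.2 A hA _ hF (hs.1.of_isClosed_subset isClosed_closure hcs) (hcs.trans hs.2)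
    have hup : PerN φ {x ∈ Ω | l < v x} A ≤ (L l).toReal := by
      refine csSup_le ⟨_, _, testN_zero A hφ, rfl⟩ ?_
      rintro r ⟨ζ, hζ, rfl⟩
      have hn := testN_neg hφ hζ
      have h3 := hL3 l _ hn
      rw [← setint_level hA.1 hA.sub (hv.1 _ hA) hn.2.2.1] at h3
      simp_rw [divN_neg'] at h3
      rw [integral_neg] at h3
      rwa [ENNReal.ofReal_le_iff_le_toReal hLt] at h3
    have hbdd : BddAbove (perSetN φ {x ∈ Ω | l < u x} A) := by
      obtain ⟨K, hK⟩ := hl.1 A hA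
      refine ⟨K / c, ?_⟩
      rintro r ⟨ζ, hζ, rfl⟩
      have h1 := hK ⟨_, hsc A ζ hζ, rfl⟩
      have hd : Differentiable ℝ ζ := hζ.1.differentiable (by norm_num)
      simp_rw [fun x => divN_const_smul' c ζ x (hd x)] at h1
      rw [integral_const_mul] at h1
      rw [le_div_iff₀ hc]
      linarith
    have hlow : ∫ x in A, {x | l < u x}.indicator (divN η) x ≤ PerN φ {x ∈ Ω | l < u x} A := by
      refine le_csSup hbdd ⟨_, testN_neg hφ hη, ?_⟩
      rw [← setint_level hA.1 hA.sub (hu.1 _ hA) hη.2.2.1]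
      simp_rw [divN_neg']
      rw [integral_neg, neg_neg]
    exact hlow.trans (hmin.trans hup)
  have hM0 := bound_nonneg hφ hM
  rw [ge, integral_eq_lintegral_pos_part_sub_lintegral_neg_part gi]
  have h1 := (lintegral_mono_ae pt).trans hL2
  have h2 := ENNReal.toReal_le_of_le_ofReal hM0 h1
  have h3 : 0 ≤ (∫⁻ l : ℝ, ENNReal.ofReal (-∫ x in A, {x | l < u x}.indicator (divN η) x)).toReal :=
    ENNReal.toReal_nonneg
  linarith


theorem minG_of_minimizing_superlevels {n : ℕ} (Φ : Rn1 n → ℝ) (φ : Rn n → ℝ)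
    (hΦ : IsNorm1 Φ) (hφ : IsNormN φ) (hcyl : Cylindrical Φ φ)
    (Ω : Set (Rn n)) (hΩ : IsOpen Ω) (u : Rn n → ℝ) (hu : BVlocFun Ω u)
    (hlev : ∀ᵐ l ∂(volume : Measure ℝ), MinPerN φ Ω {x ∈ Ω | l < u x}) :
    MinG Φ Ω u := by
  refine ⟨hu, fun A hA v hv hs => ?_⟩
  have hfin : IsFiniteMeasure (volume.restrict A) := ⟨by simpa using hA.vol.lt_top⟩
  obtain ⟨c, hc, hsc⟩ := testN_scale hφ
  obtain ⟨K, hK⟩ := hv.2 A hA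
  have hfst : ∀ η : Rn n → Rn1 n, ContDiff ℝ 1 η → HasCompactSupport η → tsupport η ⊆ A →
      (∀ x, Φ (η x) ≤ 1) → TestN A φ (fun y => (η y).1) := by
    intro η h1 h2 h3 h4
    refine ⟨contDiff_fst.comp h1, HasCompactSupport.intro h2 fun x hx => ?_, ?_, fun x => ?_⟩
    · rw [image_eq_zero_of_notMem_tsupport hx]; rfl
    · refine (closure_mono ?_).trans h3
      intro x hx hx'
      exact hx (by simp [hx'])
    · have := h4 x
      rw [hcyl] at this
      exact (le_max_left _ _).trans this
  have hsnd : ∀ η : Rn n → Rn1 n, (∀ x, Φ (η x) ≤ 1) → ∀ x, |(η x).2| ≤ 1 := by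
    intro η h4 x
    have := h4 x
    rw [hcyl] at this
    exact (le_max_right _ _).trans this
  have hsi : ∀ η : Rn n → Rn1 n, ContDiff ℝ 1 η → (∀ x, Φ (η x) ≤ 1) →
      Integrable (fun x => (η x).2) (volume.restrict A) := fun η h1 h4 =>
    Integrable.of_bound h1.continuous.snd.aestronglyMeasurable 1
      (Eventually.of_forall (hsnd η h4))
  have hsplit : ∀ w : Rn n → ℝ, IntegrableOn w A → ∀ ζ, TestN A φ ζ → ∀ s : Rn n → ℝ,
      Integrable s (volume.restrict A) →
      ∫ x in A, (w x * divN ζ x + s x) = (∫ x in A, w x * divN ζ x) + ∫ x in A, s x :=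
    fun w hw ζ hζ s hsI => integral_add (int_mul_div hw hζ.1 hζ.2.1) hsI
  have hbd : BddAbove (Gset Φ A v) := by
    refine ⟨K / c + (volume A).toReal, ?_⟩
    rintro r ⟨η, h1, h2, h3, h4, rfl⟩
    have hT := hfst η h1 h2 h3 h4
    rw [hsplit v (hv.1 A hA) _ hT _ (hsi η h1 h4)]
    refine add_le_add ?_ ?_
    · have h5 := hK ⟨_, hsc A _ hT, rfl⟩
      have hd : Differentiable ℝ (fun y => (η y).1) := hT.1.differentiable (by norm_num)
      simp_rw [fun x => divN_const_smul' c _ x (hd x), mul_left_comm _ c] at h5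
      rw [integral_const_mul] at h5
      rw [le_div_iff₀ hc]
      linarith
    · have := integral_mono (hsi η h1 h4) (integrable_const (1:ℝ))
        (fun x => (le_abs_self _).trans (hsnd η h4 x))
      simpa [Measure.real] using this
  have hΦ0 : Φ 0 ≤ 1 := by
    have := hΦ.2.1 0 0
    simp at this
    simp [this]
  refine csSup_le ⟨_, fun _ => 0, contDiff_const, HasCompactSupport.zero, by simp [tsupport],
    fun _ => hΦ0, rfl⟩ ?_
  rintro r ⟨η, h1, h2, h3, h4, rfl⟩
  have hT := hfst η h1 h2 h3 h4
  rw [hsplit u (hu.1 A hA) _ hT _ (hsi η h1 h4), ← le_sub_iff_add_le]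
  refine main_ineq hφ hΩ hu hlev hA hv hs (fun ζ hζ => ?_) hT
  rw [le_sub_iff_add_le, ← hsplit v (hv.1 A hA) _ hζ _ (hsi η h1 h4)]
  refine le_csSup hbd ⟨fun x => (ζ x, (η x).2), hζ.1.prodMk (contDiff_snd.comp h1), ?_, ?_, ?_, rfl⟩
  · refine HasCompactSupport.intro (hζ.2.1.isCompact.union h2.isCompact) fun x hx => ?_
    rw [mem_union, not_or] at hx
    rw [image_eq_zero_of_notMem_tsupport hx.1, image_eq_zero_of_notMem_tsupport hx.2]
    rfl
  · refine (closure_minimal ?_ ((isClosed_tsupport ζ).union (isClosed_tsupport η))).trans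
      (union_subset hζ.2.2.1 h3)
    intro x hx
    by_contra hxK
    rw [mem_union, not_or] at hxK
    apply hx
    simp only
    rw [image_eq_zero_of_notMem_tsupport hxK.1, image_eq_zero_of_notMem_tsupport hxK.2]
    rfl
  · intro x
    rw [hcyl]
    exact max_le (hζ.2.2.2 x) (hsnd η h4 x)
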